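/- The minimum subspace distance of the Kötter–Kschischang code K[ℓ+m, ℓ, k] is at least 2(ℓ - k + 1): for any distinct codewords U, V ∈ K, d(U,V) ≥ 2(ℓ - k + 1). -/

import Mathlib

/-- The Kötter–Kschischang codeword associated with the `q`-linearized polynomial with
coefficient vector `a`. -/
noncomputable def KKword (K L : Type*) [Field K] [Fintype K] [Field L] [Algebra K L]
    (k ℓ : ℕ) (α : Fin ℓ → L) (a : Fin k → L) : Submodule K (L × L) :=
  Submodule.span K (Set.range fun i : Fin ℓ =>
    ((α i, ∑ j : Fin k, a j * α i ^ (Fintype.card K) ^ (j : ℕ)) : L × L))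

/-- The `K`-linear map `x ↦ ∑ j, a j * x ^ (q ^ j)` given by a linearized polynomial. -/
noncomputable def linearizedMap (K : Type*) {L : Type*} [Field K] [Fintype K] [Field L]
    [Algebra K L] {k : ℕ} (a : Fin k → L) : L →ₗ[K] L :=
  ∑ j : Fin k, LinearMap.mulLeft K (a j) ∘ₗ
    ((FiniteField.frobeniusAlgHom K L) ^ (j : ℕ)).toLinearMap

theorem linearizedMap_apply (K : Type*) {L : Type*} [Field K] [Fintype K] [Field L]
    [Algebra K L] {k : ℕ} (a : Fin k → L) (x : L) :
    linearizedMap K a x = ∑ j : Fin k, a j * x ^ (Fintype.card K) ^ (j : ℕ) := by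
  have h (n : ℕ) : (FiniteField.frobeniusAlgHom K L)^[n] x = x ^ (Fintype.card K) ^ n := by
    induction n with
    | zero => simp
    | succ n ih => simp [Function.iterate_succ_apply', ih,
        FiniteField.frobeniusAlgHom_apply, ← pow_mul, pow_succ]
  simp [linearizedMap, LinearMap.sum_apply, h]

theorem KKword_eq_map (K L : Type*) [Field K] [Fintype K] [Field L] [Algebra K L]
    (k ℓ : ℕ) (α : Fin ℓ → L) (a : Fin k → L) :
    KKword K L k ℓ α a = (Submodule.span K (Set.range α)).map
      (LinearMap.prod LinearMap.id (linearizedMap K a)) := by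
  rw [Submodule.map_span, ← Set.range_comp, KKword]
  congr 2
  ext i <;> simp [linearizedMap_apply]

theorem finrank_map_id_prod {K L M : Type*} [Field K] [AddCommGroup L] [Module K L]
    [AddCommGroup M] [Module K M] (f : L →ₗ[K] M) (W : Submodule K L) :
    Module.finrank K (W.map (LinearMap.prod LinearMap.id f)) = Module.finrank K W :=
  (Submodule.equivMapOfInjective _ (fun _ _ h => (Prod.ext_iff.mp h).1) W).finrank_eq.symm

theorem map_id_prod_inf_le {K L M : Type*} [Field K] [AddCommGroup L] [Module K L]
    [AddCommGroup M] [Module K M] (f g : L →ₗ[K] M) (W : Submodule K L) :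
    W.map (LinearMap.prod LinearMap.id f) ⊓ W.map (LinearMap.prod LinearMap.id g) ≤
      (LinearMap.ker (f - g)).map (LinearMap.prod LinearMap.id f) := by
  rintro _ ⟨⟨x, _, rfl⟩, ⟨y, _, hy⟩⟩
  simp only [LinearMap.prod_apply, Function.prod_apply, LinearMap.id_apply, Prod.mk.injEq] at hy
  obtain ⟨rfl, hy⟩ := hy
  exact ⟨y, by simp [hy], rfl⟩

/-- The kernel of a nonzero linearized polynomial with `k` coefficients has dimension
less than `k`. -/
theorem finrank_ker_linearizedMap_lt (K : Type*) {L : Type*} [Field K] [Fintype K] [Field L]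
    [Algebra K L] [FiniteDimensional K L] {k : ℕ} {c : Fin k → L} (hc : c ≠ 0) :
    Module.finrank K (LinearMap.ker (linearizedMap K c)) < k := by
  classical
  have : Finite L := Module.finite_of_finite K
  have : Fintype L := Fintype.ofFinite L
  have hq : 1 < Fintype.card K := Fintype.one_lt_card
  let p : Polynomial L :=
    ∑ j : Fin k, Polynomial.monomial (Fintype.card K ^ (j : ℕ)) (c j)
  have hp : p ≠ 0 := by
    obtain ⟨i, hi⟩ := Function.ne_iff.mp hc
    intro h
    apply hi
    have h2 := congrArg (fun r => Polynomial.coeff r (Fintype.card K ^ (i : ℕ))) h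
    simpa [p, Polynomial.finsetSum_coeff, Polynomial.coeff_monomial,
      Nat.pow_right_inj hq, Fin.val_inj] using h2
  have hk : 0 < k := by
    rcases Nat.eq_zero_or_pos k with rfl | h
    · exact (hc (Subsingleton.elim _ _)).elim
    · exact h
  have hdeg : p.natDegree ≤ Fintype.card K ^ (k - 1) := by
    refine Polynomial.natDegree_sum_le_of_forall_le _ _ fun j _ => ?_
    exact (Polynomial.natDegree_monomial_le _).trans
      (Nat.pow_le_pow_right hq.le (by omega))
  have hcard : Fintype.card (LinearMap.ker (linearizedMap K c)) ≤ p.roots.toFinset.card := by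
    rw [← Fintype.card_coe]
    refine Fintype.card_le_of_injective (fun x => ⟨x.1, ?_⟩) fun x y h => ?_
    · have hx := LinearMap.mem_ker.mp x.2
      rw [linearizedMap_apply] at hx
      simpa [hp, p, Polynomial.IsRoot, Polynomial.eval_finsetSum] using hx
    · exact Subtype.ext (by simpa using h)
  have hle : Fintype.card K ^ Module.finrank K (LinearMap.ker (linearizedMap K c)) ≤
      Fintype.card K ^ (k - 1) := by
    rw [← Module.card_eq_pow_finrank]
    exact hcard.trans ((Multiset.toFinset_card_le _).trans ((Polynomial.card_roots' p).trans hdeg))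
  have := (Nat.pow_le_pow_iff_right hq).mp hle
  omega

/-- Any two distinct codewords of the Kötter–Kschischang code are at subspace distance
at least `2(ℓ - k + 1)`. -/
theorem stmt6 (K L : Type*) [Field K] [Fintype K] [Field L] [Algebra K L]
    [FiniteDimensional K L] (k ℓ : ℕ) (hk : 1 ≤ k) (hkl : k ≤ ℓ)
    (α : Fin ℓ → L) (hα : LinearIndependent K α)
    (a b : Fin k → L) (hne : KKword K L k ℓ α a ≠ KKword K L k ℓ α b) :
    2 * ((ℓ : ℤ) - (k : ℤ) + 1) ≤
      (Module.finrank K ↥(KKword K L k ℓ α a) : ℤ)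
        + (Module.finrank K ↥(KKword K L k ℓ α b) : ℤ)
        - 2 * (Module.finrank K ↥(KKword K L k ℓ α a ⊓ KKword K L k ℓ α b) : ℤ) := by
  have hab : linearizedMap K a - linearizedMap K b = linearizedMap K (a - b) := by
    ext x
    simp [linearizedMap_apply, sub_mul]
  have hc : a - b ≠ 0 := fun h => hne (by rw [sub_eq_zero.mp h])
  have hker := finrank_ker_linearizedMap_lt K hc
  have hinf := Submodule.finrank_mono (map_id_prod_inf_le (linearizedMap K a)
    (linearizedMap K b) (Submodule.span K (Set.range α)))
  rw [finrank_map_id_prod, hab] at hinf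
  rw [KKword_eq_map, KKword_eq_map]
  rw [finrank_map_id_prod, finrank_map_id_prod, finrank_span_eq_card hα, Fintype.card_fin]
  omega
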